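/- arXiv:math/9802136 — 2 statements merged into one kernel-verified Lean document; each statement's English description precedes it below -/
import Mathlib

section
/- Let p be a prime with p ≡ 5 (mod 8). Then the class number of the imaginary quadratic field ℚ(√−p) is congruent to 2 modulo 4. (In the paper this appears as the statement e(p) = 2·h_p ≡ 4 (mod 8), where h_p is the class number of ℚ(√−p).) -/
open NumberField

theorem card_mod_four_eq_two_of_sq_eq_one {G : Type*} [CommGroup G] [Finite G] (t : G)
    (ht : t ^ 2 = 1) (htors : ∀ g : G, g ^ 2 = 1 → g = 1 ∨ g = t) (hsq : ∀ g : G, g ^ 2 ≠ t) :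
    Nat.card G % 4 = 2 := by
  have ht1 : t ≠ 1 := fun h => hsq 1 (by rw [h, one_pow])
  have hker : Nat.card (powMonoidHom 2 : G →* G).ker = 2 := by
    have : ((powMonoidHom 2 : G →* G).ker : Set G) = {1, t} := by
      ext g
      simp only [SetLike.mem_coe, MonoidHom.mem_ker, powMonoidHom_apply, Set.mem_insert_iff,
        Set.mem_singleton_iff]
      exact ⟨htors g, by rintro (rfl | rfl) <;> simp [ht]⟩
    rw [← SetLike.coe_sort_coe, this, Nat.card_coe_set_eq, Set.ncard_pair ht1.symm]
  have hcard := (powMonoidHom 2 : G →* G).ker.card_mul_index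
  rw [Subgroup.index_ker, hker] at hcard
  have hodd : ¬ 2 ∣ Nat.card (powMonoidHom 2 : G →* G).range := by
    intro h
    have : Fact (Nat.Prime 2) := ⟨Nat.prime_two⟩
    obtain ⟨⟨_, g, rfl⟩, hx⟩ := exists_prime_orderOf_dvd_card' 2 h
    rw [← Subgroup.orderOf_coe] at hx
    obtain ⟨hx1, hx2⟩ := orderOf_eq_prime_iff.mp hx
    rcases htors _ hx1 with h1 | h1
    · exact hx2 h1
    · exact hsq g h1
  omega

theorem Ideal.span_two_one_add_sq {R : Type*} [CommRing R] {p : ℕ} (hp : p % 4 = 1) {β : R}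
    (hβ : β ^ 2 = -(p : R)) : (Ideal.span {2, 1 + β}) ^ 2 = Ideal.span {(2 : R)} := by
  obtain ⟨k, rfl⟩ : ∃ k, p = 4 * k + 1 := ⟨p / 4, by omega⟩
  push_cast at hβ
  rw [sq, Ideal.span_pair_mul_span_pair]
  apply le_antisymm
  · rw [Ideal.span_le]
    rintro x (rfl | rfl | rfl | rfl) <;> rw [SetLike.mem_coe, Ideal.mem_span_singleton]
    · exact ⟨2, rfl⟩
    · exact ⟨_, rfl⟩
    · exact ⟨1 + β, by ring⟩
    · exact ⟨β - 2 * k, by linear_combination hβ⟩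
  · rw [Ideal.span_singleton_le_iff_mem]
    have h : 2 * (1 + β) - (1 + β) * (1 + β) - k * (2 * 2) = (2 : R) := by
      linear_combination -hβ
    have hmem : 2 * (1 + β) - (1 + β) * (1 + β) - k * (2 * 2) ∈
        Ideal.span {2 * 2, 2 * (1 + β), (1 + β) * 2, (1 + β) * (1 + β)} :=
      sub_mem (sub_mem (Ideal.subset_span (by simp)) (Ideal.subset_span (by simp)))
        (Ideal.mul_mem_left _ _ (Ideal.subset_span (by simp)))
    rwa [h] at hmem

/-- Let `p ≡ 5 (mod 8)` be prime. Since `2` is not a square modulo `p`, every integral solution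
of `a ^ 2 + p * b ^ 2 = 2 * n ^ 2` has `n = 0`. -/
theorem eq_zero_of_sq_add_mul_sq_eq_two_mul_sq {p : ℕ} (hp : p.Prime) (hp5 : p % 8 = 5)
    (n : ℕ) (a b : ℤ) (h : a ^ 2 + p * b ^ 2 = 2 * n ^ 2) : n = 0 := by
  have : Fact p.Prime := ⟨hp⟩
  induction n using Nat.strong_induction_on generalizing a b with
  | _ n ih =>
  by_contra hn
  have hmod : (a : ZMod p) ^ 2 = 2 * (n : ZMod p) ^ 2 := by
    have := congrArg (Int.cast : ℤ → ZMod p) h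
    push_cast at this
    simpa using this
  have hn0 : (n : ZMod p) = 0 := by
    by_contra hne
    have h2 : IsSquare (2 : ZMod p) := ⟨a / n, by field_simp; rw [hmod]⟩
    rw [ZMod.exists_sq_eq_two_iff (by rintro rfl; omega)] at h2
    omega
  have ha0 : (a : ZMod p) = 0 := by
    rw [hn0] at hmod
    simpa using hmod
  rw [ZMod.natCast_eq_zero_iff] at hn0
  rw [ZMod.intCast_zmod_eq_zero_iff_dvd] at ha0
  obtain ⟨m, rfl⟩ := hn0
  obtain ⟨c, rfl⟩ := ha0
  have hp0 : (p : ℤ) ≠ 0 := by exact_mod_cast hp.ne_zero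
  have hb : (p : ℤ) ∣ b ^ 2 := ⟨2 * m ^ 2 - c ^ 2, by
    apply mul_left_cancel₀ hp0
    push_cast at h
    linear_combination h⟩
  obtain ⟨d, rfl⟩ := (Nat.prime_iff_prime_int.mp hp).dvd_of_dvd_pow hb
  have hm : m ≠ 0 := fun h0 => hn (by simp [h0])
  refine hm (ih m ?_ c d ?_)
  · nlinarith [hp.two_le, Nat.pos_of_ne_zero hm]
  · apply mul_left_cancel₀ (pow_ne_zero 2 hp0)
    push_cast at h
    linear_combination h

section
variable {K : Type*} [Field K] [NumberField K] {p : ℕ} {α : K}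

theorem exists_eq_add_mul_of_adjoin_eq_top (hα : α ^ 2 = -(p : K))
    (hK : Algebra.adjoin ℚ {α} = ⊤) (x : K) : ∃ a b : ℚ, x = a + b * α := by
  have hx : x ∈ Algebra.adjoin ℚ {α} := hK ▸ Algebra.mem_top
  induction hx using Algebra.adjoin_induction with
  | mem x hx => exact ⟨0, 1, by rw [Set.mem_singleton_iff.mp hx]; simp⟩
  | algebraMap r => exact ⟨r, 0, by simp⟩
  | add x y _ _ hx hy =>
    obtain ⟨a, b, rfl⟩ := hx
    obtain ⟨c, d, rfl⟩ := hy
    exact ⟨a + c, b + d, by push_cast; ring⟩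
  | mul x y _ _ hx hy =>
    obtain ⟨a, b, rfl⟩ := hx
    obtain ⟨c, d, rfl⟩ := hy
    exact ⟨a * c - p * b * d, a * d + b * c, by
      push_cast; linear_combination (b * d : K) * hα⟩

theorem norm_add_mul (hp : 0 < p) (hα : α ^ 2 = -(p : K))
    (hK : Algebra.adjoin ℚ {α} = ⊤) (a b : ℚ) :
    Algebra.norm ℚ ((a : K) + b * α) = a ^ 2 + p * b ^ 2 := by
  have hli : LinearIndependent ℚ ![(1 : K), α] := by
    rw [LinearIndependent.pair_iff]
    intro s t h
    simp only [Rat.smul_def, mul_one] at h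
    have h2 : ((s ^ 2 + p * t ^ 2 : ℚ) : K) = 0 := by
      push_cast
      linear_combination (s - t * α : K) * h + t ^ 2 * hα
    have h3 : s ^ 2 + p * t ^ 2 = 0 := by exact_mod_cast h2
    have hp' : (0 : ℚ) < p := by exact_mod_cast hp
    have ht : t = 0 := by
      by_contra ht
      have : 0 < t ^ 2 := by positivity
      nlinarith [mul_pos hp' this, sq_nonneg s]
    subst ht
    exact ⟨by simpa using h3, rfl⟩
  have hspan : ⊤ ≤ Submodule.span ℚ (Set.range ![(1 : K), α]) := by
    intro x _
    obtain ⟨a, b, rfl⟩ := exists_eq_add_mul_of_adjoin_eq_top hα hK x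
    rw [Matrix.range_cons_cons_empty, Submodule.mem_span_pair]
    exact ⟨a, b, by simp [Rat.smul_def]⟩
  let B := Module.Basis.mk hli hspan
  have hB : Algebra.lmul ℚ K ((a : K) + b * α) = Matrix.toLin B B !![a, -p * b; b, a] := by
    apply B.ext
    intro i
    rw [Matrix.toLin_self]
    fin_cases i
    · simp [B, Rat.smul_def]
    · simp [B, Rat.smul_def]
      linear_combination (b : K) * hα
  rw [Algebra.norm_apply]
  change LinearMap.det (Algebra.lmul ℚ K ((a : K) + b * α)) = _
  rw [hB, LinearMap.det_toLin, Matrix.det_fin_two_of]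
  ring


theorem NumberField.RingOfIntegers.exists_two_mul_eq_and_norm_eq (hp : 0 < p)
    (hα : α ^ 2 = -(p : K)) (hK : Algebra.adjoin ℚ {α} = ⊤) (x : 𝓞 K) :
    ∃ (a b : ℚ) (t : ℤ), 2 * a = t ∧ a ^ 2 + p * b ^ 2 = Algebra.norm ℤ x ∧
      x ^ 2 - t * x + (Algebra.norm ℤ x : ℤ) = 0 := by
  obtain ⟨a, b, hx⟩ := exists_eq_add_mul_of_adjoin_eq_top hα hK (algebraMap (𝓞 K) K x)
  have h0 : (Algebra.norm ℤ x : ℚ) = a ^ 2 + p * b ^ 2 := by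
    rw [Algebra.coe_norm_int, ← norm_add_mul hp hα hK, ← hx]
  have h1 : (Algebra.norm ℤ (1 + x) : ℚ) = (1 + a) ^ 2 + p * b ^ 2 := by
    have : algebraMap (𝓞 K) K (1 + x) = ((1 + a : ℚ) : K) + b * α := by
      rw [map_add, map_one, hx]
      push_cast
      ring
    rw [Algebra.coe_norm_int, ← norm_add_mul hp hα hK, ← this]
  have ht : 2 * a = ((Algebra.norm ℤ (1 + x) - Algebra.norm ℤ x - 1 : ℤ) : ℚ) := by
    push_cast
    rw [h0, h1]
    ring
  refine ⟨a, b, _, ht, h0.symm, ?_⟩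
  generalize Algebra.norm ℤ (1 + x) - Algebra.norm ℤ x - 1 = t at ht
  generalize Algebra.norm ℤ x = n at h0
  apply FaithfulSMul.algebraMap_injective (𝓞 K) K
  have ht' : (t : K) = 2 * a := by exact_mod_cast congrArg (Rat.cast : ℚ → K) ht.symm
  have hn' : (n : K) = a ^ 2 + p * b ^ 2 := by exact_mod_cast congrArg (Rat.cast : ℚ → K) h0
  simp only [map_add, map_sub, map_pow, map_mul, map_intCast, map_zero]
  rw [ht', hn', hx]
  linear_combination (b ^ 2 : K) * hα

theorem NumberField.RingOfIntegers.dvd_of_natCast_dvd_natCast {q m : ℕ} (hq : q.Prime)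
    (h : (q : 𝓞 K) ∣ m) : q ∣ m := by
  by_contra hqm
  obtain ⟨r, s, hrs⟩ := Nat.isCoprime_iff_coprime.mpr ((Nat.Prime.coprime_iff_not_dvd hq).mpr hqm)
  have hrs' : (r * q + s * m : 𝓞 K) = 1 := by exact_mod_cast congrArg (Int.cast : ℤ → 𝓞 K) hrs
  have h1 : (q : 𝓞 K) ∣ 1 := hrs' ▸ dvd_add (dvd_mul_left _ _) (h.mul_left _)
  have h2 := map_dvd (Algebra.norm ℤ) h1
  rw [← map_natCast (algebraMap ℤ (𝓞 K)), Algebra.norm_algebraMap_of_basis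
    (Module.Free.chooseBasis ℤ (𝓞 K)), map_one] at h2
  have h3 := (dvd_pow_self (q : ℤ) Fintype.card_ne_zero).trans h2
  exact hq.one_lt.ne' (Nat.dvd_one.mp (by exact_mod_cast h3))

/-- An odd prime `q ≠ p` is unramified in `ℚ(√-p)`: the ideal `(q)` is radical. -/
theorem NumberField.RingOfIntegers.natCast_dvd_of_dvd_sq (hp : p.Prime)
    (hα : α ^ 2 = -(p : K)) (hK : Algebra.adjoin ℚ {α} = ⊤) {q : ℕ} (hq : q.Prime)
    (hq2 : q ≠ 2) (hqp : q ≠ p) {x : 𝓞 K} (hx : (q : 𝓞 K) ∣ x ^ 2) : (q : 𝓞 K) ∣ x := by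
  obtain ⟨y, hy⟩ := hx
  obtain ⟨a, b, t, ht, hN, hpoly⟩ := exists_two_mul_eq_and_norm_eq hp.pos hα hK x
  set n := Algebra.norm ℤ x
  have hqZ : Prime (q : ℤ) := Nat.prime_iff_prime_int.mp hq
  have hqn : (q : ℤ) ∣ n := by
    have h := congrArg (Algebra.norm ℤ) hy
    rw [map_pow, map_mul] at h
    have hqq : (q : ℤ) ∣ Algebra.norm ℤ (q : 𝓞 K) := by
      rw [← map_natCast (algebraMap ℤ (𝓞 K)), Algebra.norm_algebraMap_of_basis
        (Module.Free.chooseBasis ℤ (𝓞 K))]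
      exact dvd_pow_self _ Fintype.card_ne_zero
    exact hqZ.dvd_of_dvd_pow (h ▸ hqq.mul_right _)
  have hcast {k l : ℤ} (h : k ∣ l) : (k : 𝓞 K) ∣ l := map_dvd (Int.castRingHom (𝓞 K)) h
  by_cases hqt : (q : ℤ) ∣ t
  · have hD : p * (2 * b) ^ 2 = ((4 * n - t ^ 2 : ℤ) : ℚ) := by
      push_cast
      rw [← hN, ← ht]
      ring
    set D := 4 * n - t ^ 2
    obtain ⟨e, he⟩ : ∃ e : ℤ, algebraMap ℤ ℚ e = 2 * p * b := by
      apply IsIntegrallyClosed.algebraMap_eq_of_integral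
      apply IsIntegral.of_pow two_pos
      have : (2 * p * b) ^ 2 = algebraMap ℤ ℚ (p * D) := by
        rw [eq_intCast]
        push_cast
        rw [← hD]
        ring
      rw [this]
      exact isIntegral_algebraMap
    have heD : e ^ 2 = p * D := by
      rw [eq_intCast] at he
      have : (e : ℚ) ^ 2 = p * D := by
        rw [he, ← hD]
        ring
      exact_mod_cast this
    have hqD : (q : ℤ) ∣ D := dvd_sub (hqn.mul_left 4) (dvd_pow hqt two_ne_zero)
    have hqe : (q : ℤ) ∣ e := hqZ.dvd_of_dvd_pow (heD ▸ hqD.mul_left _)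
    have hqD2 : (q : ℤ) ^ 2 ∣ D := by
      have hcop : IsCoprime ((q : ℤ) ^ 2) p :=
        (Nat.isCoprime_iff_coprime.mpr ((Nat.coprime_primes hq hp).mpr hqp)).pow_left
      exact hcop.dvd_of_dvd_mul_left (heD ▸ pow_dvd_pow_of_dvd hqe 2)
    have hsq : (2 * x - t) ^ 2 = ((-D : ℤ) : 𝓞 K) := by
      simp only [D]
      push_cast
      linear_combination 4 * hpoly
    have hdvd : (q : 𝓞 K) ∣ 2 * x - t := by
      rw [← IsIntegrallyClosed.pow_dvd_pow_iff two_ne_zero, hsq]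
      exact_mod_cast hcast (hqD2.neg_right)
    have h2x : (q : 𝓞 K) ∣ 2 * x :=
      (dvd_sub_left (by exact_mod_cast hcast hqt)).mp hdvd
    obtain ⟨k, hk⟩ := hq.odd_of_ne_two hq2
    have hx : x = q * x - k * (2 * x) := by
      rw [hk]
      push_cast
      ring
    rw [hx]
    exact dvd_sub (dvd_mul_right _ _) (h2x.mul_left _)
  · obtain ⟨r, s, hrs⟩ := (hqZ.coprime_iff_not_dvd).mpr hqt
    have hrs' : (r * q + s * t : 𝓞 K) = 1 := by exact_mod_cast congrArg (Int.cast : ℤ → 𝓞 K) hrs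
    obtain ⟨m, hm⟩ : (q : 𝓞 K) ∣ (n : 𝓞 K) := by exact_mod_cast hcast hqn
    exact ⟨r * x + s * (y + m), by
      linear_combination (-x) * hrs' - s * hpoly + s * hy + s * hm⟩

theorem Ideal.exists_eq_mul_of_sq_eq_span {R : Type*} [CommRing R] [IsDedekindDomain R]
    {Q J : Ideal R} {c m : R} (hc : c ≠ 0) (hQ : Q ^ 2 = Ideal.span {c}) (hQJ : Q ∣ J)
    (hJ : J ^ 2 = Ideal.span {c * m}) : ∃ J', J = Q * J' ∧ J' ^ 2 = Ideal.span {m} := by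
  obtain ⟨J', rfl⟩ := hQJ
  refine ⟨J', rfl, ?_⟩
  rw [mul_pow, ← Ideal.span_singleton_mul_span_singleton, ← hQ] at hJ
  refine mul_left_cancel₀ ?_ hJ
  rw [hQ]
  simpa using hc

theorem Ideal.dvd_of_sq_eq_span {R : Type*} [CommRing R] [IsDedekindDomain R]
    {Q J : Ideal R} {c m : R} (hQ : Q ^ 2 = Ideal.span {c})
    (hJ : J ^ 2 = Ideal.span {c * m}) : Q ∣ J := by
  rw [← UniqueFactorizationMonoid.pow_dvd_pow_iff_dvd two_ne_zero, hJ,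
    ← Ideal.span_singleton_mul_span_singleton, ← hQ]
  exact dvd_mul_right _ _

/-- An ideal of `ℚ(√-p)` whose square is generated by a natural number is principal up to the
prime above `2`. -/
theorem NumberField.exists_eq_span_of_sq_eq_span_natCast (hp : p.Prime) (hp4 : p % 4 = 1)
    {β : 𝓞 K} (hβ : β ^ 2 = -(p : 𝓞 K)) (hK : Algebra.adjoin ℚ {(β : K)} = ⊤)
    {m : ℕ} (hm : m ≠ 0) {J : Ideal (𝓞 K)} (hJ : J ^ 2 = Ideal.span {(m : 𝓞 K)}) :
    (∃ c, J = Ideal.span {c}) ∨ ∃ c, J * Ideal.span {2, 1 + β} = Ideal.span {c} := by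
  have hα : (β : K) ^ 2 = -(p : K) := by
    simpa using congrArg (algebraMap (𝓞 K) K) hβ
  have hscale (c : 𝓞 K) {J' : Ideal (𝓞 K)}
      (h : (∃ c, J' = Ideal.span {c}) ∨ ∃ c, J' * Ideal.span {2, 1 + β} = Ideal.span {c}) :
      (∃ d, Ideal.span {c} * J' = Ideal.span {d}) ∨
        ∃ d, Ideal.span {c} * J' * Ideal.span {2, 1 + β} = Ideal.span {d} := by
    rcases h with ⟨d, hd⟩ | ⟨d, hd⟩
    · exact .inl ⟨c * d, by rw [hd, Ideal.span_singleton_mul_span_singleton]⟩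
    · exact .inr ⟨c * d, by rw [mul_assoc, hd, Ideal.span_singleton_mul_span_singleton]⟩
  induction m using Nat.strong_induction_on generalizing J with
  | _ m ih =>
  rcases eq_or_ne m 1 with rfl | hm1
  · rw [Nat.cast_one, Ideal.span_singleton_one, ← Ideal.one_eq_top] at hJ
    have hJ1 : IsUnit J := (isUnit_pow_iff two_ne_zero).mp (hJ ▸ isUnit_one)
    exact .inl ⟨1, by rw [Ideal.isUnit_iff.mp hJ1, Ideal.span_singleton_one]⟩
  obtain ⟨q, hq, k, rfl⟩ := Nat.exists_prime_and_dvd hm1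
  have hk : k ≠ 0 := right_ne_zero_of_mul hm
  have hlt : k < q * k := by nlinarith [hq.two_le, Nat.pos_of_ne_zero hk]
  have hq0 : (q : 𝓞 K) ≠ 0 := by exact_mod_cast hq.ne_zero
  rw [Nat.cast_mul] at hJ
  rcases eq_or_ne q 2 with rfl | hq2
  · have hQ := Ideal.span_two_one_add_sq hp4 hβ
    obtain ⟨J', rfl, hJ'⟩ :=
      Ideal.exists_eq_mul_of_sq_eq_span hq0 hQ (Ideal.dvd_of_sq_eq_span hQ hJ) hJ
    rcases ih k hlt hk hJ' with ⟨d, hd⟩ | ⟨d, hd⟩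
    · exact .inr ⟨2 * d, by
        rw [mul_right_comm, ← sq, hQ, hd, Ideal.span_singleton_mul_span_singleton]⟩
    · exact .inl ⟨d, by rw [mul_comm, hd]⟩
  rcases eq_or_ne q p with rfl | hqp
  · have hQ : Ideal.span {β} ^ 2 = Ideal.span {(q : 𝓞 K)} := by
      rw [Ideal.span_singleton_pow, hβ, Ideal.span_singleton_neg]
    obtain ⟨J', rfl, hJ'⟩ :=
      Ideal.exists_eq_mul_of_sq_eq_span hq0 hQ (Ideal.dvd_of_sq_eq_span hQ hJ) hJ
    exact hscale β (ih k hlt hk hJ')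
  · have hdvd : Ideal.span {(q : 𝓞 K)} ∣ J := by
      rw [Ideal.dvd_iff_le]
      intro x hx
      rw [Ideal.mem_span_singleton]
      apply RingOfIntegers.natCast_dvd_of_dvd_sq hp hα hK hq hq2 hqp
      have := Ideal.pow_mem_pow hx 2
      rw [hJ, Ideal.mem_span_singleton] at this
      exact (dvd_mul_right _ _).trans this
    have hqk : q ∣ k := by
      apply RingOfIntegers.dvd_of_natCast_dvd_natCast (K := K) hq
      have := pow_dvd_pow_of_dvd hdvd 2
      rwa [hJ, Ideal.span_singleton_pow, Ideal.dvd_span_singleton, Ideal.mem_span_singleton, sq,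
        mul_dvd_mul_iff_left hq0] at this
    obtain ⟨l, rfl⟩ := hqk
    have hl : l ≠ 0 := right_ne_zero_of_mul hk
    rw [Nat.cast_mul, ← mul_assoc, ← sq] at hJ
    obtain ⟨J', rfl, hsq⟩ := Ideal.exists_eq_mul_of_sq_eq_span (pow_ne_zero 2 hq0)
      (Ideal.span_singleton_pow _ _) hdvd hJ
    exact hscale q (ih l (by nlinarith [hq.two_le, Nat.pos_of_ne_zero hl]) hl hsq)

/-- Every ideal class of order dividing two in `ℚ(√-p)` is represented by an ideal whose square
is generated by a natural number. -/
theorem NumberField.exists_mul_eq_span_and_sq_eq_span_natCast (hp : 0 < p)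
    (hα : α ^ 2 = -(p : K)) (hK : Algebra.adjoin ℚ {α} = ⊤) {I : Ideal (𝓞 K)} {x : 𝓞 K}
    (hx : x ≠ 0) (hI : I ^ 2 = Ideal.span {x}) :
    ∃ (J : Ideal (𝓞 K)) (y : 𝓞 K) (m : ℕ), y ≠ 0 ∧ m ≠ 0 ∧ I * J = Ideal.span {y} ∧
      J ^ 2 = Ideal.span {(m : 𝓞 K)} := by
  obtain ⟨a, b, t, ht, hN, hpoly⟩ := RingOfIntegers.exists_two_mul_eq_and_norm_eq hp hα hK x
  set n := Ideal.absNorm I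
  have hN0 : 0 ≤ Algebra.norm ℤ x := by
    have : (0 : ℚ) ≤ Algebra.norm ℤ x := by
      rw [← hN]
      positivity
    exact_mod_cast this
  have hn : Algebra.norm ℤ x = n ^ 2 := by
    have h := congrArg Ideal.absNorm hI
    rw [map_pow, Ideal.absNorm_span_singleton] at h
    rw [← Int.natAbs_of_nonneg hN0, ← h]
    push_cast
    rfl
  rw [hn] at hpoly
  push_cast at hpoly
  have hn0 : n ≠ 0 := by
    intro h0
    rw [h0] at hn
    exact hx (Algebra.norm_eq_zero_iff.mp (hn.trans (by simp)))
  by_cases hm : 2 * (n : ℤ) + t = 0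
  · have ht' : (t : 𝓞 K) = -(2 * n) := by
      have : t = -(2 * n) := by linarith
      rw [this]
      push_cast
      rfl
    have hxn : x = -n := by
      have : (x + n) ^ 2 = 0 := by
        rw [ht'] at hpoly
        linear_combination hpoly
      exact eq_neg_of_add_eq_zero_left (pow_eq_zero_iff two_ne_zero |>.mp this)
    refine ⟨I, x, n, hx, hn0, by rw [← sq, hI], ?_⟩
    rw [hI, hxn, Ideal.span_singleton_neg]
  · have hsq : (n + x) ^ 2 = x * ((2 * n + t : ℤ) : 𝓞 K) := by
      push_cast
      linear_combination hpoly
    have hspan : Ideal.span {(n : 𝓞 K) + x} ^ 2 = Ideal.span {x * ((2 * n + t : ℤ) : 𝓞 K)} := by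
      rw [Ideal.span_singleton_pow, hsq]
    have hdvd := Ideal.dvd_of_sq_eq_span hI hspan
    obtain ⟨J, hJ, hJ2⟩ := Ideal.exists_eq_mul_of_sq_eq_span hx hI hdvd hspan
    refine ⟨J, n + x, (2 * n + t : ℤ).natAbs, ?_, Int.natAbs_ne_zero.mpr hm, hJ.symm, ?_⟩
    · intro h0
      rw [h0, zero_pow two_ne_zero, eq_comm] at hsq
      exact mul_ne_zero hx (by exact_mod_cast hm) hsq
    · rw [hJ2]
      rcases Int.natAbs_eq (2 * n + t : ℤ) with h | h
      · conv_lhs => rw [h, Int.cast_natCast]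
      · conv_lhs => rw [h, Int.cast_neg, Int.cast_natCast, Ideal.span_singleton_neg]

theorem NumberField.not_sq_mul_span_two_eq_span (hp : p.Prime) (hp5 : p % 8 = 5)
    {β : 𝓞 K} (hβ : β ^ 2 = -(p : 𝓞 K)) (hK : Algebra.adjoin ℚ {(β : K)} = ⊤)
    {I : Ideal (𝓞 K)} (hI : I ≠ ⊥) (x : 𝓞 K) :
    I ^ 2 * Ideal.span {2, 1 + β} ≠ Ideal.span {x} := by
  intro h
  have hα : (β : K) ^ 2 = -(p : K) := by
    simpa using congrArg (algebraMap (𝓞 K) K) hβ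
  have hP : Ideal.absNorm (Ideal.span {2, 1 + β}) = 2 := by
    have h2 := congrArg Ideal.absNorm (Ideal.span_two_one_add_sq (by omega) hβ)
    have h4 : Algebra.norm ℤ (2 : 𝓞 K) = 4 := by
      have := norm_add_mul hp.pos hα hK 2 0
      have h' : (Algebra.norm ℤ (2 : 𝓞 K) : ℚ) = 4 := by
        rw [Algebra.coe_norm_int]
        change Algebra.norm ℚ (algebraMap (𝓞 K) K 2) = 4
        rw [map_ofNat]
        simpa [show (2 : ℚ) ^ 2 = 4 by norm_num] using this
      exact_mod_cast h'
    rw [map_pow, Ideal.absNorm_span_singleton, h4] at h2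
    exact Nat.pow_left_injective two_ne_zero h2
  obtain ⟨a, b, t, ht, hN, -⟩ := RingOfIntegers.exists_two_mul_eq_and_norm_eq hp.pos hα hK x
  have hN0 : (0 : ℚ) ≤ Algebra.norm ℤ x := by
    rw [← hN]
    positivity
  have h' := congrArg Ideal.absNorm h
  rw [map_mul, map_pow, hP, Ideal.absNorm_span_singleton] at h'
  set n := Ideal.absNorm I
  have hn0 : n ≠ 0 := Ideal.absNorm_eq_zero_iff.not.mpr hI
  have hn : (n : ℚ) ^ 2 * 2 = a ^ 2 + p * b ^ 2 := by
    rw [hN, ← Int.natAbs_of_nonneg (Int.cast_nonneg_iff.mp hN0), ← h']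
    push_cast
    rfl
  have hb : b * b.den = b.num := Rat.mul_den_eq_num b
  have key : (t * b.den) ^ 2 + p * (2 * b.num) ^ 2 = 2 * ((2 * n * b.den : ℕ) : ℤ) ^ 2 := by
    have : ((t * b.den) ^ 2 + p * (2 * b.num) ^ 2 : ℚ) = 2 * (2 * n * b.den) ^ 2 := by
      rw [← ht, ← hb]
      linear_combination (-4 * b.den ^ 2 : ℚ) * hn
    exact_mod_cast this
  have := eq_zero_of_sq_add_mul_sq_eq_two_mul_sq hp hp5 _ _ _ key
  simp [hn0] at this

end

/-- Let `p` be a prime with `p ≡ 5 (mod 8)`. Then the class number of the imaginary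
quadratic field `ℚ(√−p)` is congruent to `2` modulo `4`. -/
theorem classNumber_sqrt_neg_p_mod_four (p : ℕ) (hp : p.Prime) (hp5 : p % 8 = 5)
    (K : Type*) [Field K] [NumberField K] (α : K) (hα : α ^ 2 = -(p : K))
    (hK : Algebra.adjoin ℚ {α} = ⊤) :
    NumberField.classNumber K % 4 = 2 := by
  have hint : IsIntegral ℤ α := by
    apply IsIntegral.of_pow two_pos
    rw [hα]
    exact (isIntegral_natCast p).neg
  obtain ⟨β, rfl⟩ : ∃ β : 𝓞 K, algebraMap (𝓞 K) K β = α := ⟨⟨α, hint⟩, rfl⟩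
  have hβ : β ^ 2 = -(p : 𝓞 K) := by
    apply FaithfulSMul.algebraMap_injective (𝓞 K) K
    simpa using hα
  have hP2 := Ideal.span_two_one_add_sq (p := p) (by omega) hβ
  have hP0 : Ideal.span {2, 1 + β} ≠ ⊥ := by
    intro h
    have : (2 : 𝓞 K) ∈ Ideal.span {2, 1 + β} := Ideal.subset_span (by simp)
    rw [h, Ideal.mem_bot] at this
    exact two_ne_zero this
  let P : nonZeroDivisors (Ideal (𝓞 K)) :=
    ⟨Ideal.span {2, 1 + β}, mem_nonZeroDivisors_of_ne_zero hP0⟩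
  have hmk {I : nonZeroDivisors (Ideal (𝓞 K))} :
      ClassGroup.mk0 I = 1 ↔ ∃ x, (I : Ideal (𝓞 K)) = Ideal.span {x} :=
    (ClassGroup.mk0_eq_one_iff I.2).trans (Submodule.isPrincipal_iff _)
  have hPsq : ClassGroup.mk0 P ^ 2 = 1 := by
    rw [← map_pow, hmk]
    exact ⟨2, hP2⟩
  rw [NumberField.classNumber, ← Nat.card_eq_fintype_card]
  refine card_mod_four_eq_two_of_sq_eq_one (ClassGroup.mk0 P) hPsq (fun g hg => ?_) (fun g hg => ?_)
  · obtain ⟨I, rfl⟩ := ClassGroup.mk0_surjective g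
    rw [← map_pow, hmk] at hg
    obtain ⟨x, hx⟩ := hg
    have hI0 : (I : Ideal (𝓞 K)) ≠ 0 := nonZeroDivisors.coe_ne_zero I
    have hx0 : x ≠ 0 := by
      rintro rfl
      exact pow_ne_zero 2 hI0 (by simpa using hx)
    obtain ⟨J, y, m, hy, hm, hIJ, hJ⟩ :=
      NumberField.exists_mul_eq_span_and_sq_eq_span_natCast hp.pos hα hK hx0 hx
    have hJ0 : J ≠ 0 := by
      rintro rfl
      rw [mul_zero, eq_comm] at hIJ
      exact hy (by simpa using hIJ)
    let J₀ : nonZeroDivisors (Ideal (𝓞 K)) := ⟨J, mem_nonZeroDivisors_of_ne_zero hJ0⟩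
    have hIJ1 : ClassGroup.mk0 I * ClassGroup.mk0 J₀ = 1 := by
      rw [← map_mul, hmk]
      exact ⟨y, hIJ⟩
    rcases NumberField.exists_eq_span_of_sq_eq_span_natCast hp (by omega) hβ hK hm hJ with h | h
    · have : ClassGroup.mk0 J₀ = 1 := hmk.mpr h
      left
      rwa [this, mul_one] at hIJ1
    · have : ClassGroup.mk0 J₀ * ClassGroup.mk0 P = 1 := by
        rw [← map_mul, hmk]
        exact h
      right
      rw [eq_inv_of_mul_eq_one_left hIJ1, inv_eq_of_mul_eq_one_right this]
  · obtain ⟨I, rfl⟩ := ClassGroup.mk0_surjective g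
    have h : ClassGroup.mk0 I ^ 2 * ClassGroup.mk0 P = 1 := by rw [hg, ← sq, hPsq]
    rw [← map_pow, ← map_mul, hmk] at h
    obtain ⟨x, hx⟩ := h
    exact NumberField.not_sq_mul_span_two_eq_span hp hp5 hβ hK (nonZeroDivisors.coe_ne_zero I) x hx
end

section
/- Let p and q be primes with p ≡ 5 (mod 24), q ≡ 5 (mod 12), and p not a square modulo q. Let h be the class number of ℚ(√−p). Then 24 divides (p−1)(q−1) − 16, h is even, and the integer g = 1 + ((p−1)(q−1) − 16)/24 − h/2 is even. (In the paper, g is the genus of the Atkin-Lehner quotient V_B^(p) = V_B/w_p of the Shimura curve of discriminant pq, computed via the Riemann–Hurwitz formula g = (g(V_B)+1)/2 − e(p)/4 with e(p) = 2h.) -/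
open NumberField nonZeroDivisors

section QuadraticBasis

variable {R S : Type*} [CommRing R] [CommRing S] [Algebra R S]

theorem leftMulMatrix_of_basis_one_sqrt (b : Module.Basis (Fin 2) R S) (d : R) (hb0 : b 0 = 1)
    (hb1 : b 1 ^ 2 = algebraMap R S d) (u v : R) :
    Algebra.leftMulMatrix b (algebraMap R S u + algebraMap R S v * b 1) = !![u, d * v; v, u] := by
  have h0 : (algebraMap R S u + algebraMap R S v * b 1) * b 0 = u • b 0 + v • b 1 := by
    rw [hb0, Algebra.smul_def, Algebra.smul_def]; ring
  have h1 : (algebraMap R S u + algebraMap R S v * b 1) * b 1 = (d * v) • b 0 + u • b 1 := by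
    rw [hb0, Algebra.smul_def, Algebra.smul_def, map_mul, ← hb1]; ring
  ext i j
  rw [Algebra.leftMulMatrix_eq_repr_mul]
  fin_cases j
  · simp only [Fin.zero_eta, h0, map_add, map_smul]
    fin_cases i <;> simp
  · simp only [Fin.mk_one, h1, map_add, map_smul]
    fin_cases i <;> simp

theorem norm_of_basis_one_sqrt (b : Module.Basis (Fin 2) R S) (d : R) (hb0 : b 0 = 1)
    (hb1 : b 1 ^ 2 = algebraMap R S d) (u v : R) :
    Algebra.norm R (algebraMap R S u + algebraMap R S v * b 1) = u ^ 2 - d * v ^ 2 := by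
  rw [Algebra.norm_eq_matrix_det b, leftMulMatrix_of_basis_one_sqrt b d hb0 hb1, Matrix.det_fin_two]
  simp; ring

theorem trace_of_basis_one_sqrt (b : Module.Basis (Fin 2) R S) (d : R) (hb0 : b 0 = 1)
    (hb1 : b 1 ^ 2 = algebraMap R S d) (u v : R) :
    Algebra.trace R S (algebraMap R S u + algebraMap R S v * b 1) = 2 * u := by
  rw [Algebra.trace_eq_matrix_trace b, leftMulMatrix_of_basis_one_sqrt b d hb0 hb1,
    Matrix.trace_fin_two]
  simp; ring

theorem eq_add_mul_of_basis_one (b : Module.Basis (Fin 2) R S) (hb0 : b 0 = 1) (x : S) :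
    ∃ u v : R, x = algebraMap R S u + algebraMap R S v * b 1 := by
  refine ⟨b.repr x 0, b.repr x 1, ?_⟩
  conv_lhs => rw [← b.sum_repr x]
  simp [hb0, Algebra.smul_def]

/-- A basis `1, s` of `S` over `R`, given that `1` and `s` span `S` and are independent. -/
theorem exists_basis_one_of_forall_eq [Nontrivial S] (s : S)
    (hspan : ∀ x : S, ∃ u v : R, x = algebraMap R S u + algebraMap R S v * s)
    (hind : ∀ u v : R, algebraMap R S u + algebraMap R S v * s = 0 → u = 0 ∧ v = 0) :
    ∃ b : Module.Basis (Fin 2) R S, b 0 = 1 ∧ b 1 = s := by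
  have hli : LinearIndependent R ![(1 : S), s] := by
    rw [LinearIndependent.pair_iff]
    intro u v h
    exact hind u v (by simpa [Algebra.smul_def] using h)
  have hsp : ⊤ ≤ Submodule.span R (Set.range ![(1 : S), s]) := by
    rintro x -
    obtain ⟨u, v, rfl⟩ := hspan x
    simp only [Matrix.range_cons, Matrix.range_empty, Set.union_empty, Set.singleton_union]
    rw [Submodule.mem_span_pair]
    exact ⟨u, v, by simp [Algebra.smul_def]⟩
  exact ⟨Module.Basis.mk hli hsp, by simp, by simp⟩

end QuadraticBasis

theorem int_of_prime_mul_sq_eq_int {p : ℕ} (hp : p.Prime) (x : ℚ) (n : ℤ) (h : p * x ^ 2 = n) :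
    ∃ k : ℤ, x = k := by
  have hp0 : (p : ℚ) ≠ 0 := by exact_mod_cast hp.ne_zero
  have hx_integral : IsIntegral ℤ (p * x) := by
    refine IsIntegral.of_pow (n := 2) two_pos ?_
    have : ((p : ℚ) * x) ^ 2 = ((p * n : ℤ) : ℚ) := by push_cast; rw [← h]; ring
    rw [this]
    exact isIntegral_algebraMap (R := ℤ) (x := (p * n : ℤ))
  obtain ⟨s, hs⟩ := IsIntegrallyClosed.isIntegral_iff.mp hx_integral
  have hs' : (s : ℚ) = p * x := by simpa using hs
  have h2 : s ^ 2 = p * n := by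
    have : (s : ℚ) ^ 2 = p * n := by rw [hs', ← h]; ring
    exact_mod_cast this
  obtain ⟨k, rfl⟩ := (Nat.prime_iff_prime_int.mp hp).dvd_of_dvd_pow ⟨n, h2⟩
  refine ⟨k, ?_⟩
  push_cast at hs'
  exact (mul_left_cancel₀ hp0 hs').symm

theorem even_and_even_of_sq_add_mul_sq {p m k n : ℤ} (hp : p % 4 = 1)
    (h : m ^ 2 + p * k ^ 2 = 4 * n) : Even m ∧ Even k := by
  obtain ⟨c, rfl⟩ : ∃ c, p = 4 * c + 1 := ⟨p / 4, by omega⟩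
  rcases Int.even_or_odd' m with ⟨m, rfl | rfl⟩ <;> rcases Int.even_or_odd' k with ⟨k, rfl | rfl⟩
  · simp
  all_goals exfalso; ring_nf at h; omega

section RingOfIntegers

variable {K : Type*} [Field K] [NumberField K] {α : K} {p : ℕ}

theorem rat_eq_zero_of_sq_neg (hp : p.Prime) (hα : α ^ 2 = -(p : K)) (u v : ℚ)
    (h : algebraMap ℚ K u + algebraMap ℚ K v * α = 0) : u = 0 ∧ v = 0 := by
  have h1 : algebraMap ℚ K (u ^ 2 + p * v ^ 2) = algebraMap ℚ K 0 := by
    simp only [map_add, map_mul, map_pow, map_natCast, map_zero]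
    linear_combination (algebraMap ℚ K u - algebraMap ℚ K v * α) * h + (algebraMap ℚ K v) ^ 2 * hα
  have h2 := (algebraMap ℚ K).injective h1
  have hp0 : (0 : ℚ) < p := by exact_mod_cast hp.pos
  have hv : v ^ 2 = 0 := by nlinarith [sq_nonneg u, sq_nonneg v]
  have hv' : v = 0 := by simpa using hv
  subst hv'
  exact ⟨by simpa using h2, rfl⟩

theorem rat_span_of_adjoin_sqrt (hα : α ^ 2 = -(p : K)) (hK : Algebra.adjoin ℚ {α} = ⊤) (x : K) :
    ∃ u v : ℚ, x = algebraMap ℚ K u + algebraMap ℚ K v * α := by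
  have hx : x ∈ Algebra.adjoin ℚ {α} := hK ▸ Algebra.mem_top
  induction hx using Algebra.adjoin_induction with
  | mem x hx => exact ⟨0, 1, by simp_all⟩
  | algebraMap r => exact ⟨r, 0, by simp⟩
  | add x y _ _ hx hy =>
    obtain ⟨u, v, rfl⟩ := hx
    obtain ⟨u', v', rfl⟩ := hy
    exact ⟨u + u', v + v', by simp only [map_add]; ring⟩
  | mul x y _ _ hx hy =>
    obtain ⟨u, v, rfl⟩ := hx
    obtain ⟨u', v', rfl⟩ := hy
    refine ⟨u * u' - p * v * v', u * v' + u' * v, ?_⟩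
    simp only [map_add, map_sub, map_mul, map_natCast]
    linear_combination (algebraMap ℚ K v) * (algebraMap ℚ K v') * hα

/-- For a prime `p ≡ 1 mod 4`, the ring of integers of `ℚ(√-p)` is `ℤ[√-p]`. -/
theorem exists_integralBasis_sqrt_neg_prime (hp : p.Prime) (hp4 : p % 4 = 1)
    (hα : α ^ 2 = -(p : K)) (hK : Algebra.adjoin ℚ {α} = ⊤) :
    ∃ b : Module.Basis (Fin 2) ℤ (𝓞 K), b 0 = 1 ∧ b 1 ^ 2 = algebraMap ℤ (𝓞 K) (-p) := by
  obtain ⟨B, hB0, hB1⟩ := exists_basis_one_of_forall_eq α (rat_span_of_adjoin_sqrt hα hK)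
    (rat_eq_zero_of_sq_neg hp hα)
  have hB1' : B 1 ^ 2 = algebraMap ℚ K (-p) := by simp [hB1, hα]
  have hαint : IsIntegral ℤ α := by
    refine IsIntegral.of_pow (n := 2) two_pos ?_
    rw [hα]
    simpa using isIntegral_algebraMap (R := ℤ) (A := K) (x := (-p : ℤ))
  obtain ⟨s, hsα⟩ : ∃ s : 𝓞 K, algebraMap (𝓞 K) K s = α := ⟨⟨α, hαint⟩, rfl⟩
  have hs : s ^ 2 = algebraMap ℤ (𝓞 K) (-p) := by
    apply RingOfIntegers.ext
    simp [hsα, hα]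
  suffices h : ∃ b : Module.Basis (Fin 2) ℤ (𝓞 K), b 0 = 1 ∧ b 1 = s by
    obtain ⟨b, hb0, hb1⟩ := h
    exact ⟨b, hb0, by rw [hb1, hs]⟩
  refine exists_basis_one_of_forall_eq s ?_ ?_
  · intro x
    obtain ⟨u, v, huv⟩ := rat_span_of_adjoin_sqrt hα hK (algebraMap (𝓞 K) K x)
    have htr : ∃ m : ℤ, (m : ℚ) = 2 * u := by
      obtain ⟨m, hm⟩ := IsIntegrallyClosed.isIntegral_iff.mp
        (Algebra.isIntegral_trace (L := ℚ) x.isIntegral_coe)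
      rw [huv, ← hB1, trace_of_basis_one_sqrt B _ hB0 hB1'] at hm
      exact ⟨m, by simpa using hm⟩
    have hno : ∃ n : ℤ, (n : ℚ) = u ^ 2 + p * v ^ 2 := by
      obtain ⟨n, hn⟩ := IsIntegrallyClosed.isIntegral_iff.mp
        (Algebra.isIntegral_norm ℚ x.isIntegral_coe)
      rw [huv, ← hB1, norm_of_basis_one_sqrt B _ hB0 hB1'] at hn
      exact ⟨n, by simpa using hn⟩
    obtain ⟨m, hm⟩ := htr
    obtain ⟨n, hn⟩ := hno
    obtain ⟨k, hk⟩ := int_of_prime_mul_sq_eq_int hp (2 * v) (4 * n - m ^ 2)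
      (by push_cast; rw [hm, hn]; ring)
    have hmk : m ^ 2 + p * k ^ 2 = 4 * n := by
      have : (m : ℚ) ^ 2 + p * k ^ 2 = 4 * n := by rw [← hk, hm, hn]; ring
      exact_mod_cast this
    obtain ⟨⟨m', rfl⟩, ⟨k', rfl⟩⟩ := even_and_even_of_sq_add_mul_sq (by omega) hmk
    have hu : u = m' := by push_cast at hm; linarith
    have hv : v = k' := by push_cast at hk; linarith
    refine ⟨m', k', RingOfIntegers.ext ?_⟩
    refine huv.trans ?_
    rw [hu, hv]
    simp [hsα]
  · intro u v h
    have := congrArg (algebraMap (𝓞 K) K) h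
    have := rat_eq_zero_of_sq_neg hp hα u v (by simpa [hsα] using this)
    exact_mod_cast this

end RingOfIntegers

theorem card_mod_four_of_unique_involution {G : Type*} [CommGroup G] [Fintype G] (t : G)
    (ht : t ^ 2 = 1) (hsq : ∀ g : G, g ^ 2 ≠ t) (hinv : ∀ g : G, g ^ 2 = 1 → g = 1 ∨ g = t) :
    Fintype.card G % 4 = 2 := by
  have ht1 : t ≠ 1 := fun h => hsq 1 (by simp [h])
  let f : G →* G := powMonoidHom 2
  have hker : Nat.card f.ker = 2 := by
    have : (f.ker : Set G) = {1, t} := by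
      ext g
      simp only [SetLike.mem_coe, MonoidHom.mem_ker, Set.mem_insert_iff, Set.mem_singleton_iff]
      refine ⟨hinv g, ?_⟩
      rintro (rfl | rfl)
      · simp
      · exact ht
    rw [← SetLike.coe_sort_coe, this, Nat.card_coe_set_eq, Set.ncard_pair ht1.symm]
  have hodd : ¬ 2 ∣ Nat.card f.range := by
    intro h
    have : Fact (Nat.Prime 2) := ⟨Nat.prime_two⟩
    obtain ⟨⟨x, g, hg⟩, hx⟩ := exists_prime_orderOf_dvd_card' 2 h
    rw [← Subgroup.orderOf_coe] at hx
    have hx2 : x ^ 2 = 1 := by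
      have := pow_orderOf_eq_one x
      simpa only [hx] using this
    rcases hinv x hx2 with rfl | rfl
    · simp at hx
    · exact hsq g hg
  have hcard := Subgroup.card_mul_index f.ker
  rw [Subgroup.index_ker, hker, Nat.card_eq_fintype_card (α := G)] at hcard
  omega

theorem eq_zero_of_sq_add_prime_mul_sq_eq {p : ℕ} (hp : p.Prime) (hp8 : p % 8 = 5) (n : ℕ) :
    ∀ u v : ℤ, u ^ 2 + p * v ^ 2 = 2 * n ^ 2 → n = 0 := by
  have : Fact p.Prime := ⟨hp⟩
  have hpr := Nat.prime_iff_prime_int.mp hp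
  have hp0 : (p : ℤ) ≠ 0 := hpr.ne_zero
  induction n using Nat.strong_induction_on with
  | _ n ih =>
  intro u v h
  by_cases hn : p ∣ n
  · obtain ⟨n', rfl⟩ := hn
    have hu : (p : ℤ) ∣ u := hpr.dvd_of_dvd_pow (n := 2)
      ⟨2 * p * n' ^ 2 - v ^ 2, by push_cast at h; linear_combination h⟩
    obtain ⟨u', rfl⟩ := hu
    have hv : (p : ℤ) ∣ v := by
      refine hpr.dvd_of_dvd_pow (n := 2) ⟨2 * n' ^ 2 - u' ^ 2, mul_left_cancel₀ hp0 ?_⟩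
      push_cast at h
      linear_combination h
    obtain ⟨v', rfl⟩ := hv
    by_contra hne
    have hn' : n' ≠ 0 := by rintro rfl; simp at hne
    refine hn' (ih n' ?_ u' v' ?_)
    · nlinarith [hp.two_le, Nat.pos_of_ne_zero hn']
    · refine mul_left_cancel₀ (pow_ne_zero 2 hp0) ?_
      push_cast at h
      linear_combination h
  · exfalso
    have h' : (u : ZMod p) ^ 2 = 2 * (n : ZMod p) ^ 2 := by
      have := congrArg (Int.cast : ℤ → ZMod p) h
      simpa using this
    have hn0 : (n : ZMod p) ≠ 0 := by rwa [Ne, ZMod.natCast_eq_zero_iff]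
    have : IsSquare (2 : ZMod p) := by
      refine ⟨u / n, ?_⟩
      field_simp
      exact h'.symm
    rw [ZMod.exists_sq_eq_two_iff (by omega)] at this
    omega

section AmbiguousIdeals

variable {S : Type*} [CommRing S] {p : ℕ}

theorem intCast_dvd_add_mul_iff (b : Module.Basis (Fin 2) ℤ S) (hb0 : b 0 = 1) (l u v : ℤ) :
    (l : S) ∣ (u : S) + v * b 1 ↔ l ∣ u ∧ l ∣ v := by
  constructor
  · rintro ⟨y, hy⟩
    obtain ⟨c, e, rfl⟩ := eq_add_mul_of_basis_one b hb0 y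
    have h : u • b 0 + v • b 1 = (l * c) • b 0 + (l * e) • b 1 := by
      simp only [hb0, zsmul_eq_mul, mul_one, Int.cast_mul, eq_intCast] at hy ⊢
      rw [hy]; ring
    have h0 := congrArg (fun w => b.repr w 0) h
    have h1 := congrArg (fun w => b.repr w 1) h
    simp only [map_add, map_smul, Module.Basis.repr_self, Finsupp.add_apply, Finsupp.smul_apply,
      Finsupp.single_eq_same, ne_eq, zero_ne_one, one_ne_zero, not_false_eq_true,
      Finsupp.single_eq_of_ne, smul_eq_mul, mul_one, mul_zero, add_zero, zero_add] at h0 h1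
    exact ⟨⟨c, h0⟩, ⟨e, h1⟩⟩
  · rintro ⟨⟨c, rfl⟩, ⟨e, rfl⟩⟩
    exact ⟨c + e * b 1, by push_cast; ring⟩

theorem intCast_dvd_of_dvd_sq (b : Module.Basis (Fin 2) ℤ S) (hb0 : b 0 = 1)
    (hb1 : b 1 ^ 2 = -(p : S)) {l : ℤ} (hl : Prime l) (hl2 : ¬ l ∣ 2) (hlp : ¬ l ∣ p) (x : S)
    (h : (l : S) ∣ x ^ 2) : (l : S) ∣ x := by
  obtain ⟨u, v, rfl⟩ := eq_add_mul_of_basis_one b hb0 x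
  have hx : (algebraMap ℤ S u + algebraMap ℤ S v * b 1) ^ 2 =
      ((u ^ 2 - p * v ^ 2 : ℤ) : S) + ((2 * u * v : ℤ) : S) * b 1 := by
    simp only [eq_intCast]
    push_cast
    linear_combination (v : S) ^ 2 * hb1
  rw [hx, intCast_dvd_add_mul_iff b hb0] at h
  obtain ⟨h1, h2⟩ := h
  simp only [eq_intCast]
  rw [intCast_dvd_add_mul_iff b hb0]
  rcases hl.dvd_or_dvd h2 with h3 | h3
  · have hu : l ∣ u := (hl.dvd_or_dvd h3).resolve_left hl2
    refine ⟨hu, hl.dvd_of_dvd_pow (n := 2) ?_⟩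
    have : l ∣ p * v ^ 2 := by
      have := dvd_sub (dvd_pow hu two_ne_zero) h1
      simpa using this
    exact (hl.dvd_or_dvd this).resolve_left hlp
  · refine ⟨hl.dvd_of_dvd_pow (n := 2) ?_, h3⟩
    have := dvd_add h1 (Dvd.dvd.mul_left (dvd_pow h3 two_ne_zero) (p : ℤ))
    simpa using this

/-- A squarefree rational integer generating the square of an ideal of `ℤ[√-p]` is supported
at the primes dividing `2p`. -/
theorem dvd_two_mul_of_ideal_mul_self_eq_span (b : Module.Basis (Fin 2) ℤ S) (hb0 : b 0 = 1)
    (hb1 : b 1 ^ 2 = -(p : S)) {d : ℕ} (hd : Squarefree d) {A : Ideal S}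
    (hA : A * A = Ideal.span {(d : S)}) : d ∣ 2 * p := by
  rw [← Nat.prod_primeFactors_of_squarefree hd]
  refine Finset.prod_primes_dvd _ (fun l hl => (Nat.prime_of_mem_primeFactors hl).prime) ?_
  intro l hl
  have hlp := Nat.prime_of_mem_primeFactors hl
  have hld := Nat.dvd_of_mem_primeFactors hl
  by_contra hl2p
  have hA_le : A ≤ Ideal.span {((l : ℤ) : S)} := by
    intro x hx
    rw [Ideal.mem_span_singleton]
    refine intCast_dvd_of_dvd_sq b hb0 hb1 (Nat.prime_iff_prime_int.mp hlp) ?_ ?_ x ?_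
    · exact fun h => hl2p (Dvd.dvd.mul_right (by exact_mod_cast h) p)
    · exact fun h => hl2p (Dvd.dvd.mul_left (by exact_mod_cast h) 2)
    · have hxx : x ^ 2 ∈ Ideal.span {(d : S)} := by
        rw [← hA, sq]
        exact Ideal.mul_mem_mul hx hx
      rw [Int.cast_natCast]
      exact (Nat.cast_dvd_cast hld).trans (Ideal.mem_span_singleton.mp hxx)
  have hd_mem : (d : S) ∈ Ideal.span {((l : ℤ) : S)} * Ideal.span {((l : ℤ) : S)} :=
    Ideal.mul_mono hA_le hA_le (hA ▸ Ideal.mem_span_singleton_self _)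
  rw [Ideal.span_singleton_mul_span_singleton, Ideal.mem_span_singleton] at hd_mem
  have hll := (intCast_dvd_add_mul_iff b hb0 (l * l) d 0).mp (by simpa using hd_mem)
  exact hlp.not_isUnit (hd l (by exact_mod_cast hll.1))

/-- The ramified prime `(2, 1 + s)` above `2`, where `s = √-p`. -/
def primeAboveTwo (s : S) : Ideal S := Ideal.span {2, 1 + s}

theorem primeAboveTwo_mul_self {s : S} (hs : s ^ 2 = -(p : S)) (hp4 : p % 4 = 1) :
    primeAboveTwo s * primeAboveTwo s = Ideal.span {2} := by
  obtain ⟨c, rfl⟩ : ∃ c, p = 4 * c + 1 := ⟨p / 4, by omega⟩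
  push_cast at hs
  apply le_antisymm
  · rw [primeAboveTwo, Ideal.span_pair_mul_span_pair, Ideal.span_le]
    simp only [Set.insert_subset_iff, Set.singleton_subset_iff, SetLike.mem_coe,
      Ideal.mem_span_singleton]
    exact ⟨⟨2, rfl⟩, ⟨1 + s, rfl⟩, ⟨1 + s, by ring⟩, ⟨s - 2 * c, by linear_combination hs⟩⟩
  · have h2 : (2 : S) ∈ primeAboveTwo s := Ideal.subset_span (by simp)
    have hs1 : 1 + s ∈ primeAboveTwo s := Ideal.subset_span (by simp)
    rw [Ideal.span_singleton_le_iff_mem]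
    have : (2 : S) = 2 * (1 + s) - (1 + s) * (1 + s) - c * (2 * 2) := by
      linear_combination hs
    rw [this]
    exact sub_mem (sub_mem (Ideal.mul_mem_mul h2 hs1) (Ideal.mul_mem_mul hs1 hs1))
      (Ideal.mul_mem_left _ _ (Ideal.mul_mem_mul h2 h2))

theorem isPrincipal_of_span_singleton_mul [IsDomain S] {a z : S} (ha : a ≠ 0) {J : Ideal S}
    (h : Ideal.span {a} * J = Ideal.span {z}) : J.IsPrincipal := by
  have hz : z ∈ Ideal.span {a} * J := h ▸ Ideal.mem_span_singleton_self z
  obtain ⟨w, -, rfl⟩ := Ideal.mem_span_singleton_mul.mp hz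
  rw [← Ideal.span_singleton_mul_span_singleton] at h
  exact ⟨w, (Ideal.span_singleton_mul_right_inj ha).mp h⟩

theorem ideal_eq_of_mul_self_eq [IsDedekindDomain S] {A B : Ideal S} (h : A * A = B * B) :
    A = B := by
  rw [← sq, ← sq] at h
  apply dvd_antisymm
  · exact (UniqueFactorizationMonoid.pow_dvd_pow_iff_dvd two_ne_zero).mp h.dvd
  · exact (UniqueFactorizationMonoid.pow_dvd_pow_iff_dvd two_ne_zero).mp h.symm.dvd

theorem exists_eq_span_or_of_mul_self_eq_span [IsDedekindDomain S]
    {s : S} (hs : s ^ 2 = -(p : S)) (hp : p.Prime) (hp4 : p % 4 = 1) {d : ℕ} (hd : d ∣ 2 * p)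
    {A : Ideal S} (hA : A * A = Ideal.span {(d : S)}) :
    ∃ e : S, A = Ideal.span {e} ∨ A = primeAboveTwo s * Ideal.span {e} := by
  obtain ⟨d₁, d₂, h₁, h₂, rfl⟩ := (Nat.dvd_mul).mp hd
  have hp' : ∃ e : S, Ideal.span {(d₂ : S)} = Ideal.span {e} * Ideal.span {e} := by
    rcases (Nat.dvd_prime hp).mp h₂ with rfl | rfl
    · exact ⟨1, by simp⟩
    · refine ⟨s, ?_⟩
      rw [Ideal.span_singleton_mul_span_singleton, ← sq, hs, Ideal.span_singleton_neg]
  obtain ⟨e, he⟩ := hp'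
  rw [Nat.cast_mul, ← Ideal.span_singleton_mul_span_singleton, he] at hA
  refine ⟨e, ?_⟩
  rcases (Nat.dvd_prime Nat.prime_two).mp h₁ with rfl | rfl
  · left
    exact ideal_eq_of_mul_self_eq (by simpa using hA)
  · right
    apply ideal_eq_of_mul_self_eq
    rw [hA, Nat.cast_two, ← primeAboveTwo_mul_self hs hp4]
    ring

theorem int_norm_of_basis (b : Module.Basis (Fin 2) ℤ S) (hb0 : b 0 = 1)
    (hb1 : b 1 ^ 2 = -(p : S)) (u v : ℤ) :
    Algebra.norm ℤ ((u : S) + v * b 1) = u ^ 2 + p * v ^ 2 := by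
  have := norm_of_basis_one_sqrt b (-p) hb0 (by simp [hb1]) u v
  simpa using this

theorem absNorm_primeAboveTwo [IsDedekindDomain S] [Module.Free ℤ S]
    (b : Module.Basis (Fin 2) ℤ S) (hb0 : b 0 = 1) (hb1 : b 1 ^ 2 = -(p : S)) (hp4 : p % 4 = 1) :
    Ideal.absNorm (primeAboveTwo (b 1)) = 2 := by
  have : Module.Finite ℤ S := .of_basis b
  have h := congrArg Ideal.absNorm (primeAboveTwo_mul_self hb1 hp4)
  have h2 := int_norm_of_basis b hb0 hb1 2 0
  simp only [Int.cast_ofNat, Int.cast_zero, zero_mul, add_zero] at h2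
  rw [map_mul, Ideal.absNorm_span_singleton, h2] at h
  norm_num at h
  nlinarith

theorem not_isPrincipal_mul_self_mul_primeAboveTwo [IsDedekindDomain S] [Module.Free ℤ S]
    (b : Module.Basis (Fin 2) ℤ S) (hb0 : b 0 = 1) (hb1 : b 1 ^ 2 = -(p : S)) (hp : p.Prime)
    (hp8 : p % 8 = 5) {I : Ideal S} (hI : I ≠ ⊥) :
    ¬ (I * I * primeAboveTwo (b 1)).IsPrincipal := by
  have : Module.Finite ℤ S := .of_basis b
  rintro ⟨y, hy⟩
  rw [← Ideal.span] at hy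
  obtain ⟨u, v, rfl⟩ := eq_add_mul_of_basis_one b hb0 y
  have h := congrArg Ideal.absNorm hy
  simp only [eq_intCast] at h
  rw [map_mul, map_mul, absNorm_primeAboveTwo b hb0 hb1 (by omega), Ideal.absNorm_span_singleton,
    int_norm_of_basis b hb0 hb1] at h
  have h' := congrArg (Nat.cast : ℕ → ℤ) h
  rw [Int.natCast_natAbs, abs_of_nonneg (by positivity)] at h'
  have hn := eq_zero_of_sq_add_prime_mul_sq_eq hp hp8 (Ideal.absNorm I) u v
    (by push_cast at h'; linear_combination -h')
  exact hI (Ideal.absNorm_eq_zero_iff.mp hn)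

theorem exists_mul_self_eq_span_of_mul_self_eq_span [IsDedekindDomain S] [CharZero S]
    {I : Ideal S} {x z : S} {m : ℕ} (hm : m ≠ 0) (hI : I ≠ ⊥) (hx : I * I = Ideal.span {x})
    (hz : z ^ 2 = m * x) :
    ∃ (c d : ℕ) (A : Ideal S), c ≠ 0 ∧ Squarefree d ∧ A * A = Ideal.span {(d : S)} ∧
      Ideal.span {(c : S)} * I * A = Ideal.span {z} := by
  obtain ⟨d, c, hdc, hd⟩ := Nat.sq_mul_squarefree m
  have hc : c ≠ 0 := by rintro rfl; simp at hdc; exact hm hdc.symm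
  have hzI : Ideal.span {z} ^ 2 = (Ideal.span {(c : S)} * I) ^ 2 * Ideal.span {(d : S)} := by
    rw [Ideal.span_singleton_pow, hz, ← hdc, mul_pow, sq I, hx, Ideal.span_singleton_pow,
      Ideal.span_singleton_mul_span_singleton, Ideal.span_singleton_mul_span_singleton]
    push_cast
    ring_nf
  obtain ⟨A, hA⟩ := (UniqueFactorizationMonoid.pow_dvd_pow_iff_dvd two_ne_zero).mp
    (Dvd.intro _ hzI.symm)
  refine ⟨c, d, A, hc, hd, ?_, hA.symm⟩
  rw [hA, mul_pow] at hzI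
  have hcI : Ideal.span {(c : S)} * I ≠ 0 := by
    refine mul_ne_zero ?_ hI
    simpa [Ideal.zero_eq_bot] using hc
  rw [← sq]
  exact mul_left_cancel₀ (pow_ne_zero 2 hcI) hzI

/-- The only ideal classes of `ℤ[√-p]` of order dividing two are the trivial one and that of the
prime above `2`. -/
theorem isPrincipal_or_of_isPrincipal_mul_self [IsDedekindDomain S] [Module.Free ℤ S] [CharZero S]
    (b : Module.Basis (Fin 2) ℤ S) (hb0 : b 0 = 1) (hb1 : b 1 ^ 2 = -(p : S)) (hp : p.Prime)
    (hp4 : p % 4 = 1) {I : Ideal S} (hI : I ≠ ⊥) (hII : (I * I).IsPrincipal) :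
    I.IsPrincipal ∨ (I * primeAboveTwo (b 1)).IsPrincipal := by
  have : Module.Finite ℤ S := .of_basis b
  set n := Ideal.absNorm I with hn
  have hn0 : 0 < n := Nat.pos_of_ne_zero (mt Ideal.absNorm_eq_zero_iff.mp hI)
  obtain ⟨u, v, hx, hu⟩ : ∃ u v : ℤ, I * I = Ideal.span {(u : S) + v * b 1} ∧ 0 ≤ u := by
    obtain ⟨x, hx⟩ := hII
    obtain ⟨u, v, rfl⟩ := eq_add_mul_of_basis_one b hb0 x
    simp only [eq_intCast] at hx
    rcases le_total 0 u with hu | hu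
    · exact ⟨u, v, hx, hu⟩
    · refine ⟨-u, -v, ?_, by omega⟩
      rw [hx, ← Ideal.span, ← Ideal.span_singleton_neg]
      push_cast
      ring_nf
  have hnorm : u ^ 2 + p * v ^ 2 = (n : ℤ) ^ 2 := by
    have h := congrArg Ideal.absNorm hx
    rw [map_mul, Ideal.absNorm_span_singleton, int_norm_of_basis b hb0 hb1, ← hn] at h
    have h' := congrArg (Nat.cast : ℕ → ℤ) h
    rw [Int.natCast_natAbs, abs_of_nonneg (by positivity)] at h'
    push_cast at h'
    linear_combination -h'
  have hnormS : (u : S) ^ 2 + p * v ^ 2 = (n : S) ^ 2 := by 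
    exact_mod_cast congrArg (Int.cast : ℤ → S) hnorm
  lift u to ℕ using hu
  obtain ⟨c, d, A, hc, hd, hA, hcI⟩ := exists_mul_self_eq_span_of_mul_self_eq_span
    (z := ((u : ℤ) : S) + v * b 1 + n) (m := 2 * (u + n)) (by omega) hI hx (by
      push_cast at hnormS ⊢
      linear_combination (v : S) ^ 2 * hb1 - hnormS)
  have hA0 : A ≠ ⊥ := by
    rintro rfl
    have : (d : S) = 0 := Ideal.span_singleton_eq_bot.mp (by rw [← hA, Ideal.bot_mul])
    exact hd.ne_zero (by exact_mod_cast this)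
  have hcS : (c : S) ≠ 0 := by exact_mod_cast hc
  obtain ⟨e, he | he⟩ := exists_eq_span_or_of_mul_self_eq_span hb1 hp hp4
    (dvd_two_mul_of_ideal_mul_self_eq_span b hb0 hb1 hd hA) hA
  · left
    have he0 : e ≠ 0 := by rintro rfl; simp at he; exact hA0 he
    refine isPrincipal_of_span_singleton_mul (mul_ne_zero hcS he0) (Eq.trans ?_ hcI)
    rw [← Ideal.span_singleton_mul_span_singleton, he]
    ring
  · right
    have he0 : e ≠ 0 := by rintro rfl; simp at he; exact hA0 he
    refine isPrincipal_of_span_singleton_mul (mul_ne_zero hcS he0) (Eq.trans ?_ hcI)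
    rw [← Ideal.span_singleton_mul_span_singleton, he]
    ring

end AmbiguousIdeals

/-- For a prime `p ≡ 5 mod 8`, the class number of `ℚ(√-p)` is congruent to `2` modulo `4`. -/
theorem classNumber_mod_four_of_sqrt_neg_prime {K : Type*} [Field K] [NumberField K] {α : K} {p : ℕ}
    (hp : p.Prime) (hp8 : p % 8 = 5) (hα : α ^ 2 = -(p : K)) (hK : Algebra.adjoin ℚ {α} = ⊤) :
    NumberField.classNumber K % 4 = 2 := by
  obtain ⟨b, hb0, hb1⟩ := exists_integralBasis_sqrt_neg_prime hp (by omega) hα hK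
  replace hb1 : b 1 ^ 2 = -(p : 𝓞 K) := by simpa using hb1
  have hPP := primeAboveTwo_mul_self hb1 (by omega)
  have hP0 : primeAboveTwo (b 1) ∈ (Ideal (𝓞 K))⁰ := by
    rw [mem_nonZeroDivisors_iff_ne_zero]
    intro h
    rw [h, mul_zero, Ideal.zero_eq_bot, eq_comm, Ideal.span_singleton_eq_bot] at hPP
    exact two_ne_zero hPP
  set P : (Ideal (𝓞 K))⁰ := ⟨primeAboveTwo (b 1), hP0⟩
  have ht : ClassGroup.mk0 P ^ 2 = 1 := by
    rw [sq, ← map_mul, ClassGroup.mk0_eq_one_iff]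
    exact ⟨2, hPP⟩
  refine card_mod_four_of_unique_involution (ClassGroup.mk0 P) ht ?_ ?_
  · intro g hg
    obtain ⟨I, rfl⟩ := ClassGroup.mk0_surjective g
    refine not_isPrincipal_mul_self_mul_primeAboveTwo b hb0 hb1 hp hp8
      (nonZeroDivisors.coe_ne_zero I) ?_
    have : ClassGroup.mk0 (I * I * P) = 1 := by
      rw [map_mul, map_mul, ← sq, hg, ← sq, ht]
    exact (ClassGroup.mk0_eq_one_iff _).mp this
  · intro g hg
    obtain ⟨I, rfl⟩ := ClassGroup.mk0_surjective g
    rw [sq, ← map_mul, ClassGroup.mk0_eq_one_iff] at hg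
    rcases isPrincipal_or_of_isPrincipal_mul_self b hb0 hb1 hp (by omega)
      (nonZeroDivisors.coe_ne_zero I) hg with h | h
    · left
      exact (ClassGroup.mk0_eq_one_iff _).mpr h
    · right
      have h1 : ClassGroup.mk0 (I * P) = 1 := (ClassGroup.mk0_eq_one_iff _).mpr h
      rw [map_mul] at h1
      rw [sq] at ht
      exact mul_right_cancel (h1.trans ht.symm)

/-- Let `p` and `q` be primes with `p ≡ 5 (mod 24)`, `q ≡ 5 (mod 12)`, and `p` not a
square modulo `q`. Let `h` be the class number of `ℚ(√−p)`. Then `24 ∣ (p−1)(q−1) − 16`,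
`h` is even, and the genus `g = 1 + ((p−1)(q−1) − 16)/24 − h/2` is even. -/
theorem genus_of_atkin_lehner_quotient_even (p q : ℕ) (hp : p.Prime) (hq : q.Prime)
    (hp5 : p % 24 = 5) (hq5 : q % 12 = 5) (hns : ¬ IsSquare (p : ZMod q))
    (K : Type*) [Field K] [NumberField K] (α : K) (hα : α ^ 2 = -(p : K))
    (hK : Algebra.adjoin ℚ {α} = ⊤) :
    (24 : ℤ) ∣ ((p : ℤ) - 1) * ((q : ℤ) - 1) - 16 ∧
      Even (NumberField.classNumber K) ∧
      Even (1 + (((p : ℤ) - 1) * ((q : ℤ) - 1) - 16) / 24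
        - (NumberField.classNumber K : ℤ) / 2) := by
  obtain ⟨a, ha⟩ : ∃ a : ℤ, (p : ℤ) = 24 * a + 5 := ⟨p / 24, by omega⟩
  obtain ⟨c, hc⟩ : ∃ c : ℤ, (q : ℤ) = 12 * c + 5 := ⟨q / 12, by omega⟩
  have hdiv : ((p : ℤ) - 1) * ((q : ℤ) - 1) - 16 = 24 * (2 * (c + 2 * a + 6 * (a * c))) := by
    rw [ha, hc]; ring
  have hh := classNumber_mod_four_of_sqrt_neg_prime hp (by omega) hα hK
  refine ⟨⟨_, hdiv⟩, Nat.even_iff.mpr (by omega), ?_⟩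
  rw [hdiv, Int.mul_ediv_cancel_left _ (by norm_num), Int.even_iff]
  omega
end
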